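/- Let X be a paracompact Hausdorff space. Then X is a C-space if and only if for every Hausdorff topological space Y, every aspherical sequence φ_n : X ⇝ Y (n < ω) of lower locally constant set-valued mappings admits a continuous selection for its union, i.e. there exists a continuous map f : X → Y with f(x) ∈ ⋃_{n<ω} φ_n(x) for every x ∈ X. -/

import Mathlib

/-- `EmbedIn k S B` means `S ↪_k B`: every continuous map from the unit `k`-sphere of
`ℝ^{k+1}` into `S` extends to a continuous map from the closed unit `(k+1)`-ball into `B`. -/
def EmbedIn {Y : Type*} [TopologicalSpace Y] (k : ℕ) (S B : Set Y) : Prop :=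
  ∀ f : (Metric.sphere (0 : EuclideanSpace ℝ (Fin (k + 1))) 1) → Y,
    Continuous f → Set.range f ⊆ S →
      ∃ g : (Metric.closedBall (0 : EuclideanSpace ℝ (Fin (k + 1))) 1) → Y,
        Continuous g ∧ Set.range g ⊆ B ∧
          ∀ z, g (Set.inclusion Metric.sphere_subset_closedBall z) = f z

/-- A set-valued mapping `Φ : X ⇝ Y` is lower locally constant if
`{x | K ⊆ Φ x}` is open for every compact `K ⊆ Y`. -/
def LowerLocallyConstant {X Y : Type*} [TopologicalSpace X] [TopologicalSpace Y]
    (Φ : X → Set Y) : Prop :=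
  ∀ K : Set Y, IsCompact K → IsOpen {x | K ⊆ Φ x}

/-- `X` is a C-space. -/
def IsCSpace (X : Type*) [TopologicalSpace X] : Prop :=
  ∀ U : ℕ → Set (Set X),
    (∀ n, (∀ u ∈ U n, IsOpen u) ∧ ⋃₀ U n = Set.univ) →
      ∃ V : ℕ → Set (Set X),
        (∀ n, ∀ v ∈ V n, IsOpen v) ∧
        (∀ n, (V n).Pairwise Disjoint) ∧
        (∀ n, ∀ v ∈ V n, ∃ u ∈ U n, v ⊆ u) ∧
        (⋃ n, ⋃₀ V n) = Set.univ

/-- The simplex of barycentric weights carried by the finite vertex set `A`. -/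
def weightSimplex {ι : Type*} (A : Finset ι) : Set (ι → ℝ) :=
  {t | (∀ i, 0 ≤ t i) ∧ (∀ i ∉ A, t i = 0) ∧ ∑ i ∈ A, t i = 1}

section WeightSimplex

variable {ι : Type*}

theorem isClosed_weightSimplex (A : Finset ι) : IsClosed (weightSimplex A) := by
  have h : weightSimplex A = (⋂ i, {t : ι → ℝ | 0 ≤ t i}) ∩
      ((⋂ i, ⋂ (_ : i ∉ A), {t : ι → ℝ | t i = 0}) ∩ {t : ι → ℝ | ∑ i ∈ A, t i = 1}) := by
    ext t
    simp [weightSimplex]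
  rw [h]
  refine (isClosed_iInter fun i => isClosed_le continuous_const (continuous_apply i)).inter
    (IsClosed.inter ?_ (isClosed_eq (by fun_prop) continuous_const))
  exact isClosed_iInter fun i => isClosed_iInter fun _ =>
    isClosed_eq (continuous_apply i) continuous_const

theorem isCompact_weightSimplex (A : Finset ι) : IsCompact (weightSimplex A) := by
  refine (isCompact_univ_pi fun _ : ι => isCompact_Icc (a := (0 : ℝ)) (b := 1)).of_isClosed_subset
    (isClosed_weightSimplex A) ?_
  rintro t ⟨h0, hz, hs⟩ i -
  refine ⟨h0 i, ?_⟩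
  by_cases hi : i ∈ A
  · exact hs ▸ Finset.single_le_sum (fun j _ => h0 j) hi
  · exact (hz i hi).trans_le zero_le_one

theorem mem_weightSimplex_of_support {A B : Finset ι} {t : ι → ℝ} (ht : t ∈ weightSimplex A)
    (hB : ∀ i ∉ B, t i = 0) : t ∈ weightSimplex B := by
  classical
  refine ⟨ht.1, hB, ?_⟩
  rw [← ht.2.2, Finset.sum_subset (Finset.subset_union_right (s₁ := A)) fun i _ hi => hB i hi,
    ← Finset.sum_subset (Finset.subset_union_left (s₂ := B)) fun i _ hi => ht.2.1 i hi]

theorem weightSimplex_nonempty_index {A : Finset ι} {t : ι → ℝ} (ht : t ∈ weightSimplex A) :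
    A.Nonempty := by
  rw [Finset.nonempty_iff_ne_empty]
  rintro rfl
  simpa using ht.2.2

theorem exists_eq_zero_of_not_subset {A B : Finset ι} {t : ι → ℝ} (ht : t ∈ weightSimplex B)
    (hAB : ¬A ⊆ B) : ∃ i ∈ A, t i = 0 := by
  obtain ⟨i, hi, hiB⟩ := Finset.not_subset.1 hAB
  exact ⟨i, hi, ht.2.1 i hiB⟩

end WeightSimplex

/-- The simplex spanned by the origin and the standard basis vectors. -/
def cornerSimplex (n : ℕ) : Set (EuclideanSpace ℝ (Fin n)) :=
  {s | (∀ i, 0 ≤ s i) ∧ ∑ i, s i ≤ 1}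

theorem isClosed_cornerSimplex (n : ℕ) : IsClosed (cornerSimplex n) := by
  have h : cornerSimplex n = (⋂ i, {s : EuclideanSpace ℝ (Fin n) | 0 ≤ s i}) ∩
      {s : EuclideanSpace ℝ (Fin n) | ∑ i, s i ≤ 1} := by
    ext t
    simp [cornerSimplex]
  rw [h]
  exact (isClosed_iInter fun i => isClosed_le continuous_const (by fun_prop)).inter
    (isClosed_le (by fun_prop) continuous_const)

theorem convex_cornerSimplex (n : ℕ) : Convex ℝ (cornerSimplex n) := by
  rintro s ⟨hs, hs'⟩ t ⟨ht, ht'⟩ a b ha hb hab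
  refine ⟨fun i => ?_, ?_⟩
  · have := hs i
    have := ht i
    simp only [PiLp.add_apply, PiLp.smul_apply, smul_eq_mul]
    positivity
  · simp only [PiLp.add_apply, PiLp.smul_apply, smul_eq_mul, Finset.sum_add_distrib,
      ← Finset.mul_sum]
    nlinarith

theorem isBounded_cornerSimplex (n : ℕ) : Bornology.IsBounded (cornerSimplex n) := by
  refine (Metric.isBounded_closedBall (x := 0) (r := √n)).subset ?_
  rintro s ⟨hs, hs'⟩
  rw [mem_closedBall_zero_iff, EuclideanSpace.norm_eq]
  refine Real.sqrt_le_sqrt ?_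
  calc ∑ i, ‖s i‖ ^ 2 ≤ ∑ i : Fin n, (1 : ℝ) := Finset.sum_le_sum fun i _ => ?_
    _ = n := by simp
  have : s i ≤ 1 := (Finset.single_le_sum (fun j _ => hs j) (Finset.mem_univ i)).trans hs'
  rw [Real.norm_of_nonneg (hs i)]
  nlinarith [hs i]

theorem interior_cornerSimplex (n : ℕ) :
    interior (cornerSimplex (n + 1)) = {s | (∀ i, 0 < s i) ∧ ∑ i, s i < 1} := by
  apply Set.Subset.antisymm
  · intro s hs
    have hmem := interior_subset hs
    have key : ∀ v : EuclideanSpace ℝ (Fin (n + 1)),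
        ∃ ε > 0, s + (ε : ℝ) • v ∈ cornerSimplex (n + 1) := by
      intro v
      have hc : Filter.Tendsto (fun ε : ℝ => s + ε • v) (nhdsWithin 0 (Set.Ioi 0)) (nhds s) := by
        have : Continuous fun ε : ℝ => s + ε • v := by fun_prop
        simpa using (this.tendsto 0).mono_left nhdsWithin_le_nhds
      obtain ⟨ε, h1, h2⟩ := ((hc.eventually (mem_interior_iff_mem_nhds.1 hs)).and
        self_mem_nhdsWithin).exists
      exact ⟨ε, h2, h1⟩
    refine ⟨fun i => ?_, ?_⟩
    · obtain ⟨ε, hε, h⟩ := key (-EuclideanSpace.single i 1)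
      have := h.1 i
      simp at this
      linarith
    · obtain ⟨ε, hε, h⟩ := key (EuclideanSpace.single 0 1)
      have := h.2
      simp [Finset.sum_add_distrib] at this
      linarith
  · refine interior_maximal (fun s hs => ⟨fun i => (hs.1 i).le, hs.2.le⟩) ?_
    have h : {s : EuclideanSpace ℝ (Fin (n + 1)) | (∀ i, 0 < s i) ∧ ∑ i, s i < 1} =
        (⋂ i, {s : EuclideanSpace ℝ (Fin (n + 1)) | 0 < s i}) ∩
          {s : EuclideanSpace ℝ (Fin (n + 1)) | ∑ i, s i < 1} := by
      ext t
      simp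
    rw [h]
    exact (isOpen_iInter_of_finite fun i => isOpen_lt continuous_const (by fun_prop)).inter
      (isOpen_lt (by fun_prop) continuous_const)

theorem interior_cornerSimplex_nonempty (n : ℕ) : (interior (cornerSimplex (n + 1))).Nonempty := by
  rw [interior_cornerSimplex]
  refine ⟨WithLp.toLp 2 fun _ => ((n : ℝ) + 2)⁻¹, fun i => ?_, ?_⟩
  · simp only
    positivity
  · simp only [Finset.sum_const, Finset.card_univ, Fintype.card_fin, nsmul_eq_mul]
    push_cast
    rw [mul_inv_lt_iff₀ (by positivity)]
    linarith

/-- A map on the boundary of a `(k + 1)`-dimensional weight simplex with values in `S` extends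
over the simplex with values in `B` as soon as `S ↪_k B`. -/
theorem EmbedIn.exists_extension_weightSimplex {ι Y : Type*} [TopologicalSpace Y] {k : ℕ}
    {S B : Set Y} (h : EmbedIn k S B) (A : Finset ι) (hA : A.card = k + 2) (H : (ι → ℝ) → Y)
    (hc : ContinuousOn H {t | t ∈ weightSimplex A ∧ ∃ i ∈ A, t i = 0})
    (hm : Set.MapsTo H {t | t ∈ weightSimplex A ∧ ∃ i ∈ A, t i = 0} S) :
    ∃ g : (ι → ℝ) → Y, ContinuousOn g (weightSimplex A) ∧ Set.MapsTo g (weightSimplex A) B ∧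
      ∀ t ∈ weightSimplex A, (∃ i ∈ A, t i = 0) → g t = H t := by
  classical
  have hclosed := isClosed_cornerSimplex (k + 1)
  obtain ⟨e, -, hcl, hfr⟩ := exists_homeomorph_image_interior_closure_frontier_eq_unitBall
    (convex_cornerSimplex (k + 1)) (interior_cornerSimplex_nonempty k)
    (isBounded_cornerSimplex (k + 1))
  rw [hclosed.closure_eq] at hcl
  rw [hclosed.frontier_eq, interior_cornerSimplex] at hfr
  let v : Fin (k + 2) ≃ A := (A.equivFinOfCardEq hA).symm
  let toCorner : (ι → ℝ) → EuclideanSpace ℝ (Fin (k + 1)) :=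
    fun t => WithLp.toLp 2 fun j => t (v j.succ)
  let ofCorner : EuclideanSpace ℝ (Fin (k + 1)) → ι → ℝ := fun s i =>
    if hi : i ∈ A then (Fin.cons (1 - ∑ j, s j) s : Fin (k + 2) → ℝ) (v.symm ⟨i, hi⟩) else 0
  have hsum : ∀ F : ι → ℝ, ∑ i ∈ A, F i = F (v 0) + ∑ j : Fin (k + 1), F (v j.succ) := by
    intro F
    rw [← Finset.sum_coe_sort, ← v.sum_comp, Fin.sum_univ_succ]
  have hof : ∀ s j, ofCorner s (v j) = (Fin.cons (1 - ∑ j, s j) s : Fin (k + 2) → ℝ) j := by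
    intro s j
    simp [ofCorner]
  have hof0 : ∀ s, ofCorner s (v 0) = 1 - ∑ j, s j := fun s => by simp [hof]
  have hofs : ∀ s j, ofCorner s (v j.succ) = s j := fun s j => by simp [hof]
  have hsurj : ∀ i ∈ A, ∃ j, (v j : ι) = i := fun i hi => ⟨v.symm ⟨i, hi⟩, by simp⟩
  have hof_cont : Continuous ofCorner := by
    refine continuous_pi fun i => ?_
    by_cases hi : i ∈ A
    · simp only [ofCorner, hi, dite_true]
      generalize v.symm ⟨i, hi⟩ = j
      refine Fin.cases ?_ (fun j => ?_) j
      · simp only [Fin.cons_zero]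
        fun_prop
      · simp only [Fin.cons_succ]
        fun_prop
    · simp only [ofCorner, hi, dite_false]
      exact continuous_const
  have hto_cont : Continuous toCorner := by fun_prop
  have hof_mem : ∀ s ∈ cornerSimplex (k + 1), ofCorner s ∈ weightSimplex A := by
    rintro s ⟨hs, hs'⟩
    refine ⟨fun i => ?_, fun i hi => by simp [ofCorner, hi], ?_⟩
    · by_cases hi : i ∈ A
      · obtain ⟨j, rfl⟩ := hsurj i hi
        refine Fin.cases ?_ (fun j => ?_) j
        · rw [hof0]
          linarith
        · rw [hofs]
          exact hs j
      · simp [ofCorner, hi]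
    · rw [hsum, hof0]
      simp only [hofs]
      ring
  have hto_mem : ∀ t ∈ weightSimplex A, toCorner t ∈ cornerSimplex (k + 1) := by
    rintro t ⟨h0, -, h1⟩
    refine ⟨fun j => h0 _, ?_⟩
    rw [hsum] at h1
    have := h0 (v 0)
    simp only [toCorner]
    linarith
  have hof_to : ∀ t ∈ weightSimplex A, ofCorner (toCorner t) = t := by
    rintro t ⟨-, hz, h1⟩
    rw [hsum] at h1
    ext i
    by_cases hi : i ∈ A
    · obtain ⟨j, rfl⟩ := hsurj i hi
      refine Fin.cases ?_ (fun j => ?_) j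
      · rw [hof0]
        simp only [toCorner]
        linarith
      · rw [hofs]
    · simp [ofCorner, hi, hz i hi]
  have hof_bd : ∀ z : Metric.sphere (0 : EuclideanSpace ℝ (Fin (k + 1))) 1,
      ofCorner (e.symm z) ∈ {t | t ∈ weightSimplex A ∧ ∃ i ∈ A, t i = 0} := by
    rintro ⟨z, hz⟩
    rw [← hfr] at hz
    obtain ⟨s, ⟨hs, hs'⟩, rfl⟩ := hz
    simp only [Homeomorph.symm_apply_apply]
    refine ⟨hof_mem s hs, ?_⟩
    by_contra! hne
    refine hs' ⟨fun j => ?_, ?_⟩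
    · exact (hs.1 j).lt_of_ne (hofs s j ▸ hne _ (v j.succ).2).symm
    · refine hs.2.lt_of_ne fun h1 => hne _ (v 0).2 ?_
      rw [hof0, h1, sub_self]
  have hto_bd : ∀ t ∈ weightSimplex A, (∃ i ∈ A, t i = 0) →
      e (toCorner t) ∈ Metric.sphere (0 : EuclideanSpace ℝ (Fin (k + 1))) 1 := by
    rintro t ht ⟨i, hi, hti⟩
    rw [← hfr]
    refine Set.mem_image_of_mem _ ⟨hto_mem t ht, ?_⟩
    rintro ⟨h1, h2⟩
    obtain ⟨j, rfl⟩ := hsurj i hi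
    revert hti
    refine Fin.cases (fun hti => ?_) (fun j hti => ?_) j
    · have := hsum t
      rw [ht.2.2, hti] at this
      simp only [toCorner] at h2
      linarith
    · exact (h1 j).ne' hti
  obtain ⟨g, hg, hgB, hgf⟩ := h (fun z => H (ofCorner (e.symm z)))
    (hc.comp_continuous (by fun_prop) hof_bd)
    (by rintro _ ⟨z, rfl⟩; exact hm (hof_bd z))
  have hball : ∀ t ∈ weightSimplex A,
      e (toCorner t) ∈ Metric.closedBall (0 : EuclideanSpace ℝ (Fin (k + 1))) 1 := fun t ht =>
    hcl ▸ Set.mem_image_of_mem _ (hto_mem t ht)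
  refine ⟨fun t => if ht : t ∈ weightSimplex A then g ⟨e (toCorner t), hball t ht⟩ else H t,
    ?_, ?_, ?_⟩
  · rw [continuousOn_iff_continuous_domRestrict]
    have : (weightSimplex A).domRestrict
        (fun t => if ht : t ∈ weightSimplex A then g ⟨e (toCorner t), hball t ht⟩ else H t) =
        fun t : weightSimplex A => g ⟨e (toCorner t), hball t t.2⟩ := by
      funext t
      simp [Set.domRestrict]
    rw [this]
    exact hg.comp (by fun_prop)
  · intro t ht
    simp only [ht, dite_true]
    exact hgB ⟨_, rfl⟩
  · intro t ht hz
    simp only [ht, dite_true]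
    have := hgf ⟨e (toCorner t), hto_bd t ht hz⟩
    simpa [Set.inclusion, hof_to t ht] using this

theorem continuousOn_boundary_weightSimplex {ι Y : Type*} [TopologicalSpace Y] [DecidableEq ι]
    {A : Finset ι} {H : (ι → ℝ) → Y}
    (h : ∀ a ∈ A, ContinuousOn H (weightSimplex (A.erase a))) :
    ContinuousOn H {t | t ∈ weightSimplex A ∧ ∃ i ∈ A, t i = 0} := by
  have hU : ContinuousOn H (⋃ a : A, weightSimplex (A.erase a)) :=
    (locallyFinite_of_finite _).continuousOn_iUnion (fun a => isClosed_weightSimplex _)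
      fun a => h a a.2
  refine hU.mono ?_
  rintro t ⟨ht, i, hi, hti⟩
  refine Set.mem_iUnion.2 ⟨⟨i, hi⟩, mem_weightSimplex_of_support ht fun j hj => ?_⟩
  by_cases hji : j = i
  · exact hji ▸ hti
  · exact ht.2.1 j fun hjA => hj (Finset.mem_erase.2 ⟨hji, hjA⟩)

/-- A map over a subcomplex `L` sending `k`-dimensional simplices into `ψ k` extends over the
simplices of dimension less than `N` of a complex `S`, with the same property. -/
theorem exists_extension_weightSimplex_complex {ι Y : Type*} [TopologicalSpace Y]
    {ψ : ℕ → Set Y} (hne : (ψ 0).Nonempty) (hψ : ∀ k, EmbedIn k (ψ k) (ψ (k + 1)))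
    {S L : Set (Finset ι)} (hS : ∀ A ∈ S, ∀ B ⊆ A, B.Nonempty → B ∈ S)
    (hL : ∀ A ∈ L, ∀ B ⊆ A, B.Nonempty → B ∈ L) (H : (ι → ℝ) → Y)
    (hH : ∀ A ∈ L, ContinuousOn H (weightSimplex A) ∧
      Set.MapsTo H (weightSimplex A) (ψ (A.card - 1))) (N : ℕ) :
    ∃ h : (ι → ℝ) → Y, (∀ A ∈ L, Set.EqOn h H (weightSimplex A)) ∧
      ∀ A ∈ S, A ∈ L ∨ A.card ≤ N → ContinuousOn h (weightSimplex A) ∧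
        Set.MapsTo h (weightSimplex A) (ψ (A.card - 1)) := by
  classical
  have : Nonempty Y := ⟨hne.some⟩
  induction N with
  | zero =>
    refine ⟨H, fun A _ => Set.eqOn_refl _ _, fun A _ hA => ?_⟩
    by_cases hAL : A ∈ L
    · exact hH A hAL
    · have hA0 : A = ∅ := by simpa [hAL] using hA
      have : weightSimplex A = ∅ := Set.eq_empty_of_forall_notMem fun t ht =>
        (weightSimplex_nonempty_index ht).ne_empty hA0
      simp [this, Set.MapsTo]
  | succ N ih =>
    obtain ⟨h, hhL, hh⟩ := ih
    have hext : ∀ A ∈ S, A ∉ L → A.card = N + 1 → ∃ g : (ι → ℝ) → Y,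
        ContinuousOn g (weightSimplex A) ∧ Set.MapsTo g (weightSimplex A) (ψ N) ∧
        ∀ t ∈ weightSimplex A, (∃ i ∈ A, t i = 0) → g t = h t := by
      intro A hAS _ hA
      cases N with
      | zero =>
        obtain ⟨y, hy⟩ := hne
        refine ⟨fun _ => y, continuousOn_const, fun _ _ => hy, ?_⟩
        rintro t ht ⟨i, hi, hti⟩
        obtain ⟨a, rfl⟩ := Finset.card_eq_one.1 hA
        have := ht.2.2
        simp_all
      | succ k =>
        have hface : ∀ a ∈ A, ContinuousOn h (weightSimplex (A.erase a)) ∧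
            Set.MapsTo h (weightSimplex (A.erase a)) (ψ k) := by
          intro a ha
          have hcard : (A.erase a).card = k + 1 := by
            rw [Finset.card_erase_of_mem ha, hA]
            rfl
          have := hh (A.erase a) (hS A hAS _ (Finset.erase_subset _ _)
            (Finset.card_pos.1 (by omega))) (Or.inr hcard.le)
          rwa [hcard, Nat.add_sub_cancel] at this
        refine (hψ k).exists_extension_weightSimplex A hA h
          (continuousOn_boundary_weightSimplex fun a ha => (hface a ha).1) ?_
        rintro t ⟨ht, i, hi, hti⟩
        refine (hface i hi).2 (mem_weightSimplex_of_support ht fun j hj => ?_)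
        by_cases hji : j = i
        · exact hji ▸ hti
        · exact ht.2.1 j fun hjA => hj (Finset.mem_erase.2 ⟨hji, hjA⟩)
    choose! g hgc hgm hgb using hext
    let P : (ι → ℝ) → Finset ι → Prop := fun t A =>
      (A ∈ S ∧ A ∉ L ∧ A.card = N + 1) ∧ t ∈ weightSimplex A
    let h' : (ι → ℝ) → Y := fun t => if ht : ∃ A, P t A then g ht.choose t else h t
    have hold : ∀ B, B ∈ L ∨ B.card ≤ N → Set.EqOn h' h (weightSimplex B) := by
      intro B hB t htB
      by_cases ht : ∃ A, P t A
      · simp only [h', ht, dite_true]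
        obtain ⟨⟨h1, h2, h3⟩, h4⟩ := ht.choose_spec
        refine hgb _ h1 h2 h3 t h4 (exists_eq_zero_of_not_subset htB fun hsub => ?_)
        rcases hB with hB | hB
        · exact h2 (hL B hB _ hsub (weightSimplex_nonempty_index h4))
        · have := Finset.card_le_card hsub
          omega
      · simp only [h', ht, dite_false]
    have hnew : ∀ B ∈ S, B ∉ L → B.card = N + 1 → Set.EqOn h' (g B) (weightSimplex B) := by
      intro B h1' h2' h3' t htB
      have ht : ∃ A, P t A := ⟨B, ⟨h1', h2', h3'⟩, htB⟩
      simp only [h', ht, dite_true]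
      obtain ⟨⟨h1, h2, h3⟩, h4⟩ := ht.choose_spec
      by_cases hEq : ht.choose = B
      · rw [hEq]
      · rw [hgb _ h1 h2 h3 t h4 (exists_eq_zero_of_not_subset htB fun hsub =>
            hEq (Finset.eq_of_subset_of_card_le hsub (by omega))),
          hgb _ h1' h2' h3' t htB (exists_eq_zero_of_not_subset h4 fun hsub =>
            hEq (Finset.eq_of_subset_of_card_le hsub (by omega)).symm)]
    refine ⟨h', fun A hA => (hold A (Or.inl hA)).trans (hhL A hA), fun A hAS hA => ?_⟩
    by_cases hA' : A ∈ L ∨ A.card ≤ N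
    · exact ⟨(hh A hAS hA').1.congr (hold A hA'), (hh A hAS hA').2.congr (hold A hA').symm⟩
    · push Not at hA'
      have hcard : A.card = N + 1 := by
        have := hA.resolve_left hA'.1
        omega
      have hEq := hnew A hAS hA'.1 hcard
      rw [hcard, Nat.add_sub_cancel]
      exact ⟨(hgc A hAS hA'.1 hcard).congr hEq, (hgm A hAS hA'.1 hcard).congr hEq.symm⟩

section PartialSelection

variable {X Y : Type*} [TopologicalSpace X] [TopologicalSpace Y]

/-- The first `n` of the open covers `O m` (indexed by the points of `X`) are locally finite, and
`H` maps each simplex with vertices in distinct ones of these covers, whose members have a common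
point `z` in their closures, continuously into the term of `φ` at `z` given by its dimension. -/
def IsPartialSelection (φ : ℕ → X → Set Y) (n : ℕ) (O : ℕ → X → Set X) (H : (ℕ × X → ℝ) → Y) :
    Prop :=
  (∀ m < n, (∀ u, IsOpen (O m u)) ∧ ⋃ u, O m u = Set.univ ∧ LocallyFinite (O m)) ∧
    ∀ A : Finset (ℕ × X), Set.InjOn Prod.fst (A : Set (ℕ × X)) → (∀ a ∈ A, a.1 < n) →
      ∀ z, (∀ a ∈ A, z ∈ closure (O a.1 a.2)) →
        ContinuousOn H (weightSimplex A) ∧ Set.MapsTo H (weightSimplex A) (φ (A.card - 1) z)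

theorem IsPartialSelection.exists_succ [T2Space X] [ParacompactSpace X] {φ : ℕ → X → Set Y}
    (hne : ∀ x, (φ 0 x).Nonempty) (hφ : ∀ n, LowerLocallyConstant (φ n))
    (hasp : ∀ n x, EmbedIn n (φ n x) (φ (n + 1) x)) {n : ℕ} {O : ℕ → X → Set X}
    {H : (ℕ × X → ℝ) → Y} (hOH : IsPartialSelection φ n O H) :
    ∃ O' H', IsPartialSelection φ (n + 1) O' H' ∧ (∀ m < n, O' m = O m) ∧
      ∀ t, (∀ x, t (n, x) = 0) → H' t = H t := by
  classical
  obtain ⟨hO, hH⟩ := hOH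
  have hT : ∀ x, {a : ℕ × X | a.1 < n ∧ x ∈ closure (O a.1 a.2)}.Finite := by
    intro x
    refine ((Set.finite_lt_nat n).biUnion fun m hm =>
      ((hO m hm).2.2.closure.point_finite x).image (Prod.mk m)).subset ?_
    rintro ⟨m, u⟩ ⟨h1, h2⟩
    exact Set.mem_biUnion h1 ⟨u, h2, rfl⟩
  let T : X → Finset (ℕ × X) := fun x => (hT x).toFinset
  have hTmem : ∀ x a, a ∈ T x ↔ a.1 < n ∧ x ∈ closure (O a.1 a.2) := fun x a => by simp [T]
  let S : X → Set (Finset (ℕ × X)) := fun x =>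
    {A | Set.InjOn Prod.fst (A : Set (ℕ × X)) ∧ A ⊆ insert (n, x) (T x)}
  have hSfin : ∀ x, (S x).Finite := fun x =>
    ((insert (n, x) (T x)).powerset.finite_toSet).subset fun A hA =>
      Finset.mem_coe.2 (Finset.mem_powerset.2 hA.2)
  have hext : ∀ x, ∃ h : (ℕ × X → ℝ) → Y,
      (∀ A : Finset (ℕ × X), Set.InjOn Prod.fst (A : Set (ℕ × X)) → A ⊆ T x →
        Set.EqOn h H (weightSimplex A)) ∧
      ∀ A ∈ S x, ContinuousOn h (weightSimplex A) ∧
        Set.MapsTo h (weightSimplex A) (φ (A.card - 1) x) := by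
    intro x
    obtain ⟨h, h1, h2⟩ := exists_extension_weightSimplex_complex (ψ := fun k => φ k x) (hne x)
      (fun k => hasp k x) (S := S x)
      (L := {A | Set.InjOn Prod.fst (A : Set (ℕ × X)) ∧ A ⊆ T x})
      (fun A hA B hBA _ => ⟨hA.1.mono (by exact_mod_cast hBA), hBA.trans hA.2⟩)
      (fun A hA B hBA _ => ⟨hA.1.mono (by exact_mod_cast hBA), hBA.trans hA.2⟩) H
      (fun A hA => hH A hA.1 (fun a ha => ((hTmem x a).1 (hA.2 ha)).1) x
        fun a ha => ((hTmem x a).1 (hA.2 ha)).2)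
      ((insert (n, x) (T x)).card)
    exact ⟨h, fun A hA hA' => h1 A ⟨hA, hA'⟩,
      fun A hA => h2 A hA (Or.inr (Finset.card_le_card hA.2))⟩
  choose h hhH hhS using hext
  have hW : ∀ x, ∀ᶠ z in nhds x, (∀ m < n, ∀ u, z ∈ closure (O m u) → x ∈ closure (O m u)) ∧
      ∀ A ∈ S x, h x '' weightSimplex A ⊆ φ (A.card - 1) z := by
    intro x
    refine Filter.Eventually.and ?_ ?_
    · refine (Filter.eventually_all_finite (Set.finite_lt_nat n)).2 fun m hm => ?_
      filter_upwards [(hO m hm).2.2.closure.iInter_compl_mem_nhds (fun _ => isClosed_closure) x]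
        with z hz u hzu
      by_contra hxu
      exact Set.mem_iInter₂.1 hz u hxu hzu
    · refine (Filter.eventually_all_finite (hSfin x)).2 fun A hA => ?_
      exact (hφ _ _ ((isCompact_weightSimplex A).image_of_continuousOn (hhS x A hA).1)).mem_nhds
        (hhS x A hA).2.image_subset
  have hC : ∀ x, ∃ C ∈ nhds x, IsClosed C ∧ ∀ z ∈ C,
      (∀ m < n, ∀ u, z ∈ closure (O m u) → x ∈ closure (O m u)) ∧
      ∀ A ∈ S x, h x '' weightSimplex A ⊆ φ (A.card - 1) z := fun x =>
    exists_mem_nhds_isClosed_subset (hW x)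
  choose C hCx hCc hCW using hC
  obtain ⟨V, hVo, hVU, hVf, hVC⟩ := precise_refinement (fun x => interior (C x))
    (fun x => isOpen_interior)
    (Set.iUnion_eq_univ_iff.2 fun x => ⟨x, mem_interior_iff_mem_nhds.2 (hCx x)⟩)
  have hVcl : ∀ x, closure (V x) ⊆ C x := fun x =>
    closure_minimal ((hVC x).trans interior_subset) (hCc x)
  let O' : ℕ → X → Set X := fun m => if m = n then V else O m
  have hO'n : O' n = V := by simp [O']
  have hO'm : ∀ m < n, O' m = O m := fun m hm => by simp [O', hm.ne]
  let H' : (ℕ × X → ℝ) → Y := fun t =>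
    if ht : ∃ x, t (n, x) ≠ 0 then h ht.choose t else H t
  have hH' : ∀ t, (∀ x, t (n, x) = 0) → H' t = H t := fun t ht => by simp [H', ht]
  refine ⟨O', H', ⟨fun m hm => ?_, fun A hA hAn z hz => ?_⟩, hO'm, hH'⟩
  · rcases (Nat.lt_succ_iff_lt_or_eq.1 hm) with hm | rfl
    · rw [hO'm m hm]
      exact hO m hm
    · rw [hO'n]
      exact ⟨hVo, hVU, hVf⟩
  · by_cases hx : ∃ x, (n, x) ∈ A
    · obtain ⟨x, hx⟩ := hx
      have hlt : ∀ a ∈ A, a ≠ (n, x) → a.1 < n := fun a ha hne =>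
        (Nat.lt_succ_iff_lt_or_eq.1 (hAn a ha)).resolve_right fun h => hne (hA ha hx h)
      have hzC : z ∈ C x := hVcl x (by simpa [hO'n] using hz _ hx)
      have hAT : ∀ a ∈ A, a ≠ (n, x) → a ∈ T x := fun a ha hne => by
        have hm := hlt a ha hne
        have hza := hz a ha
        rw [hO'm _ hm] at hza
        exact (hTmem x a).2 ⟨hm, (hCW x z hzC).1 _ hm _ hza⟩
      have hAS : A ∈ S x := ⟨hA, fun a ha => by
        by_cases hne : a = (n, x)
        · simp [hne]
        · exact Finset.mem_insert_of_mem (hAT a ha hne)⟩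
      have hEq : Set.EqOn H' (h x) (weightSimplex A) := by
        intro t ht
        by_cases htn : ∃ x', t (n, x') ≠ 0
        · have hmem : (n, htn.choose) ∈ A := by
            by_contra hmem
            exact htn.choose_spec (ht.2.1 _ hmem)
          have : htn.choose = x := congrArg Prod.snd (hA hmem hx rfl)
          simp only [H', htn, dite_true, this]
        · push Not at htn
          rw [hH' t htn]
          refine (hhH x (A.erase (n, x)) (hA.mono (by simp)) (fun a ha => ?_)
            (mem_weightSimplex_of_support ht fun a ha => ?_)).symm
          · exact hAT a (Finset.mem_of_mem_erase ha) (Finset.ne_of_mem_erase ha)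
          · by_cases hne : a = (n, x)
            · exact hne ▸ htn x
            · exact ht.2.1 a fun haA => ha (Finset.mem_erase.2 ⟨hne, haA⟩)
      exact ⟨(hhS x A hAS).1.congr hEq,
        (Set.mapsTo_iff_image_subset.2 ((hCW x z hzC).2 A hAS)).congr hEq.symm⟩
    · push Not at hx
      have hlt : ∀ a ∈ A, a.1 < n := fun a ha =>
        (Nat.lt_succ_iff_lt_or_eq.1 (hAn a ha)).resolve_right fun h =>
          hx a.2 (h ▸ ha)
      have hEq : Set.EqOn H' H (weightSimplex A) := fun t ht =>
        hH' t fun x => ht.2.1 _ (hx x)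
      have := hH A hA hlt z fun a ha => by
        have := hz a ha
        rwa [hO'm _ (hlt a ha)] at this
      exact ⟨this.1.congr hEq, this.2.congr hEq.symm⟩

theorem exists_covers_selection [T2Space X] [ParacompactSpace X] {φ : ℕ → X → Set Y}
    (hne : ∀ x, (φ 0 x).Nonempty) (hφ : ∀ n, LowerLocallyConstant (φ n))
    (hasp : ∀ n x, EmbedIn n (φ n x) (φ (n + 1) x)) [Nonempty Y] :
    ∃ (O : ℕ → X → Set X) (H : (ℕ × X → ℝ) → Y), ∀ n, IsPartialSelection φ n O H := by
  classical
  have hbase : IsPartialSelection φ 0 (fun _ _ => (∅ : Set X))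
      (fun _ => Classical.arbitrary Y) := by
    refine ⟨fun m hm => absurd hm (Nat.not_lt_zero m), fun A _ hA z _ => ?_⟩
    refine ⟨continuousOn_const, fun t ht => ?_⟩
    obtain ⟨a, ha⟩ := weightSimplex_nonempty_index ht
    exact absurd (hA a ha) (Nat.not_lt_zero _)
  let St : ℕ → Type _ := fun n =>
    {s : (ℕ → X → Set X) × ((ℕ × X → ℝ) → Y) // IsPartialSelection φ n s.1 s.2}
  have hstep : ∀ n (s : St n), ∃ s' : St (n + 1), (∀ m < n, s'.1.1 m = s.1.1 m) ∧
      ∀ t, (∀ x, t (n, x) = 0) → s'.1.2 t = s.1.2 t := by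
    rintro n ⟨⟨O, H⟩, hs⟩
    obtain ⟨O', H', h, h'⟩ := hs.exists_succ hne hφ hasp
    exact ⟨⟨(O', H'), h⟩, h'⟩
  choose next hnextO hnextH using hstep
  let s : ∀ n, St n := fun n => Nat.rec (motive := St) ⟨(_, _), hbase⟩ next n
  have hsO : ∀ m n, m < n → (s n).1.1 m = (s (m + 1)).1.1 m := by
    intro m n hmn
    induction n, hmn using Nat.le_induction with
    | base => rfl
    | succ n hn ih => exact (hnextO n (s n) m hn).trans ih
  have hsH : ∀ t : ℕ × X → ℝ, ∀ N n, (∀ a, t a ≠ 0 → a.1 < N) → N ≤ n →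
      (s n).1.2 t = (s N).1.2 t := by
    intro t N n hN hn
    induction n, hn using Nat.le_induction with
    | base => rfl
    | succ n hn ih =>
      refine (hnextH n (s n) t fun x => ?_).trans ih
      by_contra hx
      exact absurd (hN _ hx) (not_lt.2 hn)
  let H : (ℕ × X → ℝ) → Y := fun t =>
    if ht : ∃ N, ∀ a, t a ≠ 0 → a.1 < N then (s ht.choose).1.2 t else Classical.arbitrary Y
  have hH : ∀ t N, (∀ a, t a ≠ 0 → a.1 < N) → H t = (s N).1.2 t := by
    intro t N hN
    have ht : ∃ N, ∀ a, t a ≠ 0 → a.1 < N := ⟨N, hN⟩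
    simp only [H, ht, dite_true]
    rw [← hsH t _ (max ht.choose N) ht.choose_spec (le_max_left _ _),
      hsH t _ (max ht.choose N) hN (le_max_right _ _)]
  refine ⟨fun m => (s (m + 1)).1.1 m, H, fun n => ⟨fun m hm => ?_, fun A hA hAn z hz => ?_⟩⟩
  · exact (s (m + 1)).2.1 m (Nat.lt_succ_self m)
  · have hEq : Set.EqOn H (s n).1.2 (weightSimplex A) := fun t ht => hH t n fun a ha =>
      hAn a (by_contra fun haA => ha (ht.2.1 a haA))
    have := (s n).2.2 A hA hAn z fun a ha => by
      rw [hsO _ _ (hAn a ha)]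
      exact hz a ha
    exact ⟨this.1.congr hEq, this.2.congr hEq.symm⟩

end PartialSelection

/-- On a paracompact C-space, the union of an aspherical sequence of lower locally constant
mappings has a continuous selection. -/
theorem IsCSpace.exists_selection {X Y : Type*} [TopologicalSpace X] [TopologicalSpace Y]
    [T2Space X] [ParacompactSpace X] (hX : IsCSpace X) {φ : ℕ → X → Set Y}
    (hne : ∀ n x, (φ n x).Nonempty) (hφ : ∀ n, LowerLocallyConstant (φ n))
    (hasp : ∀ n x, EmbedIn n (φ n x) (φ (n + 1) x)) :
    ∃ f : X → Y, Continuous f ∧ ∀ x, f x ∈ ⋃ n, φ n x := by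
  classical
  rcases isEmpty_or_nonempty X with hemp | hnonemp
  · exact ⟨fun x => isEmptyElim x, continuous_of_const fun x => isEmptyElim x,
      fun x => isEmptyElim x⟩
  have : Nonempty Y := ⟨(hne 0 (Classical.arbitrary X)).some⟩
  obtain ⟨O, H, hOH⟩ := exists_covers_selection (hne 0) hφ hasp
  have hO := fun m => (hOH (m + 1)).1 m (Nat.lt_succ_self m)
  obtain ⟨V, hVo, hVd, hVr, hVc⟩ := hX (fun n => Set.range (O n)) fun n =>
    ⟨by rintro _ ⟨u, rfl⟩; exact (hO n).1 u, by rw [Set.sUnion_range]; exact (hO n).2.1⟩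
  have hVr' : ∀ n, ∀ v ∈ V n, ∃ u, v ⊆ O n u := by
    intro n v hv
    obtain ⟨_, ⟨u, rfl⟩, hu⟩ := hVr n v hv
    exact ⟨u, hu⟩
  choose! c hc using hVr'
  let W : ℕ → X → Set X := fun n u => ⋃₀ {v | v ∈ V n ∧ c n v = u}
  have hWo : ∀ n u, IsOpen (W n u) := fun n u => isOpen_sUnion fun v hv => hVo n v hv.1
  have hWO : ∀ n u, W n u ⊆ O n u := fun n u => Set.sUnion_subset fun v hv => hv.2 ▸ hc n v hv.1
  have hWd : ∀ n u u' z, z ∈ W n u → z ∈ W n u' → u = u' := by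
    rintro n u u' z ⟨v, ⟨hv, rfl⟩, hzv⟩ ⟨v', ⟨hv', rfl⟩, hzv'⟩
    by_contra hne
    exact Set.disjoint_left.1 (hVd n hv hv' fun h => hne (h ▸ rfl)) hzv hzv'
  have hWV : ∀ n z, z ∈ ⋃₀ V n → ∃ u, z ∈ W n u := by
    rintro n z ⟨v, hv, hz⟩
    exact ⟨c n v, v, ⟨hv, rfl⟩, hz⟩
  obtain ⟨p, hp⟩ := PartitionOfUnity.exists_isSubordinate isClosed_univ (fun n => ⋃₀ V n)
    (fun n => isOpen_sUnion (hVo n)) hVc.ge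
  let t : X → ℕ × X → ℝ := fun z a => if z ∈ W a.1 a.2 then p a.1 z else 0
  have ht_cont : Continuous t := by
    refine continuous_pi fun a => continuous_iff_continuousAt.2 fun z => ?_
    by_cases hz : z ∈ tsupport (p a.1)
    · obtain ⟨u, hu⟩ := hWV a.1 z (hp a.1 hz)
      have hev := (hWo a.1 u).mem_nhds hu
      by_cases hua : u = a.2
      · refine (p a.1).continuous.continuousAt.congr ?_
        filter_upwards [hev] with y hy
        simp [t, ← hua, hy]
      · refine (continuousAt_const (y := (0 : ℝ))).congr ?_
        filter_upwards [hev] with y hy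
        have : y ∉ W a.1 a.2 := fun hy' => hua (hWd _ _ _ y hy hy')
        simp [t, this]
    · refine (continuousAt_const (y := (0 : ℝ))).congr ?_
      filter_upwards [(isClosed_tsupport (p a.1)).isOpen_compl.mem_nhds hz] with y hy
      simp [t, image_eq_zero_of_notMem_tsupport hy]
  have hlocal : ∀ z, ∃ A : Finset (ℕ × X), Set.InjOn Prod.fst (A : Set (ℕ × X)) ∧
      (∀ a ∈ A, z ∈ O a.1 a.2) ∧ ∀ᶠ y in nhds z, t y ∈ weightSimplex A := by
    intro z
    have hu : ∀ n ∈ p.fintsupport z, ∃ u, z ∈ W n u := fun n hn =>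
      hWV n z (hp n ((p.mem_fintsupport_iff z n).1 hn))
    choose! u hu using hu
    let A : Finset (ℕ × X) := (p.fintsupport z).image fun n => (n, u n)
    have hA : ∀ a, a ∈ A ↔ a.1 ∈ p.fintsupport z ∧ a.2 = u a.1 := by
      rintro ⟨n, x⟩
      simp only [A, Finset.mem_image, Prod.mk.injEq]
      constructor
      · rintro ⟨m, hm, rfl, rfl⟩
        exact ⟨hm, rfl⟩
      · rintro ⟨h, rfl⟩
        exact ⟨n, h, rfl, rfl⟩
    refine ⟨A, fun a ha b hb hab => ?_, fun a ha => ?_, ?_⟩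
    · refine Prod.ext hab ?_
      rw [((hA a).1 ha).2, ((hA b).1 hb).2, hab]
    · obtain ⟨h1, h2⟩ := (hA a).1 ha
      exact hWO _ _ (h2 ▸ hu _ h1)
    · have hev : ∀ᶠ y in nhds z, ∀ n ∈ p.fintsupport z, y ∈ W n (u n) :=
        (Filter.eventually_all_finset _).2 fun n hn => (hWo _ _).mem_nhds (hu n hn)
      filter_upwards [hev, p.eventually_finsupport_subset z] with y hy hsupp
      refine ⟨fun a => ?_, fun a ha => ?_, ?_⟩
      · simp only [t]
        split_ifs
        exacts [p.nonneg _ _, le_rfl]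
      · simp only [t]
        split_ifs with hya
        · by_contra hpa
          have hmem := hsupp ((p.mem_finsupport y).2 hpa)
          exact ha ((hA a).2 ⟨hmem, hWd _ _ _ y hya (hy _ hmem)⟩)
        · rfl
      · rw [Finset.sum_image fun a _ b _ hab => congrArg Prod.fst hab,
          ← p.sum_finsupport' (Set.mem_univ y) hsupp]
        exact Finset.sum_congr rfl fun n hn => by simp [t, hy n hn]
  have hH : ∀ z, ∀ A : Finset (ℕ × X), Set.InjOn Prod.fst (A : Set (ℕ × X)) →
      (∀ a ∈ A, z ∈ O a.1 a.2) →
      ContinuousOn H (weightSimplex A) ∧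
        Set.MapsTo H (weightSimplex A) (φ (A.card - 1) z) := by
    intro z A hA hz
    exact (hOH (A.sup Prod.fst + 1)).2 A hA
      (fun a ha => Nat.lt_succ_of_le (Finset.le_sup (f := Prod.fst) ha)) z
      fun a ha => subset_closure (hz a ha)
  refine ⟨H ∘ t, continuous_iff_continuousAt.2 fun z => ?_, fun z => ?_⟩
  · obtain ⟨A, hA, hAz, hev⟩ := hlocal z
    have h1 := (hH z A hA hAz).1 (t z) hev.self_of_nhds
    exact h1.tendsto.comp (tendsto_nhdsWithin_iff.2 ⟨ht_cont.continuousAt, hev⟩)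
  · obtain ⟨A, hA, hAz, hev⟩ := hlocal z
    exact Set.mem_iUnion.2 ⟨_, (hH z A hA hAz).2 hev.self_of_nhds⟩

/-- Every open cover of a paracompact Hausdorff space has a `σ`-disjoint open refinement. -/
theorem exists_sigmaDisjoint_open_refinement {X : Type*} [TopologicalSpace X] [T2Space X]
    [ParacompactSpace X] (U : Set (Set X)) (hU : ∀ u ∈ U, IsOpen u) (hUc : ⋃₀ U = Set.univ) :
    ∃ W : ℕ → Set (Set X), (∀ k, ∀ w ∈ W k, IsOpen w) ∧ (∀ k, (W k).Pairwise Disjoint) ∧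
      (∀ k, ∀ w ∈ W k, ∃ u ∈ U, w ⊆ u) ∧ ⋃ k, ⋃₀ W k = Set.univ := by
  classical
  obtain ⟨p, hp⟩ := PartitionOfUnity.exists_isSubordinate isClosed_univ (fun u : U => (u : Set X))
    (fun u => hU u u.2) (by rw [← Set.sUnion_eq_iUnion, hUc])
  let D : Finset U → Set X := fun S => {x | ∀ i ∈ S, 0 < p i x ∧ ∀ j ∉ S, p j x < p i x}
  have hDo : ∀ S, IsOpen (D S) := by
    intro S
    rw [isOpen_iff_eventually]
    intro x hx
    have h1 : ∀ᶠ y in nhds x,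
        ∀ i ∈ S, 0 < p i y ∧ ∀ j ∈ p.fintsupport x, j ∉ S → p j y < p i y := by
      refine (Filter.eventually_all_finset _).2 fun i hi => ?_
      refine ((p i).continuous.continuousAt.eventually_const_lt (hx i hi).1).and
        ((Filter.eventually_all_finset _).2 fun j _ => ?_)
      refine Filter.eventually_imp_distrib_left.2 fun hj => ?_
      exact (p j).continuous.continuousAt.eventually_lt (p i).continuous.continuousAt
        ((hx i hi).2 j hj)
    filter_upwards [h1, p.eventually_finsupport_subset x] with y hy hsupp i hi
    refine ⟨(hy i hi).1, fun j hj => ?_⟩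
    by_cases hjy : p j y = 0
    · exact hjy ▸ (hy i hi).1
    · exact (hy i hi).2 j (hsupp ((p.mem_finsupport y).2 hjy)) hj
  refine ⟨fun k => D '' {S | S.card = k + 1}, ?_, ?_, ?_, ?_⟩
  · rintro k _ ⟨S, -, rfl⟩
    exact hDo S
  · rintro k _ ⟨S, hS, rfl⟩ _ ⟨S', hS', rfl⟩ hne
    have hSS : S ≠ S' := fun h => hne (h ▸ rfl)
    refine Set.disjoint_left.2 fun x hx hx' => ?_
    obtain ⟨i, hi, hi'⟩ := Finset.not_subset.1 fun h =>
      hSS (Finset.eq_of_subset_of_card_le h (hS'.trans hS.symm).le)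
    obtain ⟨j, hj', hj⟩ := Finset.not_subset.1 fun h =>
      hSS (Finset.eq_of_subset_of_card_le h (hS.trans hS'.symm).le).symm
    exact lt_asymm ((hx i hi).2 j hj) ((hx' j hj').2 i hi')
  · rintro k _ ⟨S, hS, rfl⟩
    have hcard : S.card = k + 1 := hS
    obtain ⟨i, hi⟩ := Finset.card_pos.1 (show 0 < S.card by omega)
    exact ⟨i, i.2, fun x hx => hp i (subset_tsupport _ (hx i hi).1.ne')⟩
  · refine Set.eq_univ_of_forall fun x => ?_
    have hpos : (p.finsupport x).Nonempty := by
      obtain ⟨i, hi⟩ := p.exists_pos (Set.mem_univ x)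
      exact ⟨i, (p.mem_finsupport x).2 hi.ne'⟩
    refine Set.mem_iUnion.2 ⟨(p.finsupport x).card - 1, D (p.finsupport x),
      ⟨_, (Nat.sub_add_cancel hpos.card_pos).symm, rfl⟩, fun i hi => ?_⟩
    have hi0 : 0 < p i x := (p.nonneg i x).lt_of_ne ((p.mem_finsupport x).1 hi).symm
    refine ⟨hi0, fun j hj => ?_⟩
    have : p j x = 0 := by
      by_contra h
      exact hj ((p.mem_finsupport x).2 h)
    rwa [this]

/-- Finitely supported nonnegative functions, to be given the weak topology of all functionals. -/
def NonnegFinsupp (ι : Type*) : Type _ := {y : ι →₀ ℝ // ∀ i, 0 ≤ y i}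

namespace NonnegFinsupp

variable {ι : Type*}

/-- Evaluation of the linear functional with coefficients `w`. -/
noncomputable def pairing (y : NonnegFinsupp ι) (w : ι → ℝ) : ℝ :=
  Finsupp.linearCombination ℝ w y.1

noncomputable instance : TopologicalSpace (NonnegFinsupp ι) :=
  TopologicalSpace.induced pairing inferInstance

theorem continuous_pairing (w : ι → ℝ) : Continuous fun y : NonnegFinsupp ι => y.pairing w :=
  (continuous_apply w).comp
    (continuous_induced_dom (f := (pairing : NonnegFinsupp ι → (ι → ℝ) → ℝ)))

theorem continuous_iff {Z : Type*} [TopologicalSpace Z] {f : Z → NonnegFinsupp ι} :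
    Continuous f ↔ ∀ w, Continuous fun z => (f z).pairing w :=
  continuous_induced_rng.trans continuous_pi_iff

theorem pairing_single [DecidableEq ι] (y : NonnegFinsupp ι) (i : ι) :
    y.pairing (Pi.single i 1) = y.1 i := by
  simp +contextual [pairing, Finsupp.linearCombination_apply, Finsupp.sum, Pi.single_apply,
    eq_comm]

theorem continuous_coord (i : ι) : Continuous fun y : NonnegFinsupp ι => y.1 i := by
  classical
  simpa only [pairing_single] using continuous_pairing (Pi.single i (1 : ℝ))

instance : T2Space (NonnegFinsupp ι) :=
  T2Space.of_injective_continuous (f := fun (y : NonnegFinsupp ι) (i : ι) => y.1 i)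
    (fun _ _ h => Subtype.ext (Finsupp.ext fun i => congrFun h i))
    (continuous_pi continuous_coord)

theorem mul_le_pairing (y : NonnegFinsupp ι) {w : ι → ℝ} (hw : ∀ i, 0 ≤ w i) (i : ι) :
    y.1 i * w i ≤ y.pairing w := by
  rw [pairing, Finsupp.linearCombination_apply, Finsupp.sum]
  by_cases hi : i ∈ y.1.support
  · exact Finset.single_le_sum (f := fun j => y.1 j • w j)
      (fun j _ => mul_nonneg (y.2 j) (hw j)) hi
  · rw [Finsupp.notMem_support_iff.1 hi, zero_mul]
    exact Finset.sum_nonneg fun j _ => mul_nonneg (y.2 j) (hw j)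

theorem finite_support_of_isCompact {K : Set (NonnegFinsupp ι)} (hK : IsCompact K) :
    {i | ∃ y ∈ K, y.1 i ≠ 0}.Finite := by
  by_contra hinf
  let e := Set.Infinite.natEmbedding _ hinf
  have he : ∀ k, ∃ y ∈ K, y.1 (e k) ≠ 0 := fun k => (e k).2
  choose y hyK hy using he
  have hinj : Function.Injective fun k => (e k : ι) := Subtype.val_injective.comp e.injective
  let w : ι → ℝ := Function.extend (fun k => (e k : ι)) (fun k => k / (y k).1 (e k)) 0
  have hw : ∀ i, 0 ≤ w i := by
    intro i
    by_cases hi : ∃ k, (e k : ι) = i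
    · obtain ⟨k, rfl⟩ := hi
      simp only [w, hinj.extend_apply]
      exact div_nonneg k.cast_nonneg ((y k).2 _)
    · simp [w, Function.extend_apply' _ _ _ hi]
  obtain ⟨M, hM⟩ := (hK.image (continuous_pairing w)).bddAbove
  obtain ⟨k, hk⟩ := exists_nat_gt M
  have h1 : (y k).pairing w ≤ M := hM ⟨y k, hyK k, rfl⟩
  have h2 := mul_le_pairing (y k) hw (e k)
  have h3 : w (e k) = k / (y k).1 (e k) := hinj.extend_apply _ _ k
  rw [h3, mul_div_cancel₀ _ (hy k)] at h2
  linarith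

end NonnegFinsupp

/-- There is a retraction `N` onto the unit sphere such that the radial extension `‖z‖ * F (N z)`
of every continuous function `F` on the sphere is continuous, including at the origin. -/
theorem exists_sphere_retraction (k : ℕ) :
    ∃ N : EuclideanSpace ℝ (Fin (k + 1)) → Metric.sphere (0 : EuclideanSpace ℝ (Fin (k + 1))) 1,
      (∀ z : Metric.sphere (0 : EuclideanSpace ℝ (Fin (k + 1))) 1, N z = z) ∧
      ∀ F : Metric.sphere (0 : EuclideanSpace ℝ (Fin (k + 1))) 1 → ℝ, Continuous F →
        Continuous fun z => ‖z‖ * F (N z) := by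
  classical
  have hmem : ∀ z : EuclideanSpace ℝ (Fin (k + 1)), z ≠ 0 → ‖z‖⁻¹ • z ∈
      Metric.sphere (0 : EuclideanSpace ℝ (Fin (k + 1))) 1 := fun z hz => by
    rw [mem_sphere_zero_iff_norm, norm_smul, norm_inv, norm_norm,
      inv_mul_cancel₀ (norm_ne_zero_iff.2 hz)]
  obtain ⟨b, hb⟩ := NormedSpace.sphere_nonempty (x := (0 : EuclideanSpace ℝ (Fin (k + 1))))
    (r := 1) |>.2 zero_le_one
  refine ⟨fun z => if hz : z ≠ 0 then ⟨‖z‖⁻¹ • z, hmem z hz⟩ else ⟨b, hb⟩, ?_, ?_⟩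
  · rintro ⟨z, hz⟩
    have hz1 : ‖z‖ = 1 := mem_sphere_zero_iff_norm.1 hz
    have hz0 : z ≠ 0 := norm_ne_zero_iff.1 (hz1 ▸ one_ne_zero)
    simp [hz0, hz1]
  · intro F hF
    refine continuous_iff_continuousAt.2 fun z => ?_
    by_cases hz : z = 0
    · subst hz
      obtain ⟨M, hM⟩ := (isCompact_range hF).isBounded.exists_norm_le
      rw [ContinuousAt, norm_zero, zero_mul]
      refine squeeze_zero_norm (a := fun z => ‖z‖ * M) (fun z => ?_) ?_
      · rw [norm_mul, norm_norm]
        exact mul_le_mul_of_nonneg_left (hM _ ⟨_, rfl⟩) (norm_nonneg z)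
      · have : Continuous fun z : EuclideanSpace ℝ (Fin (k + 1)) => ‖z‖ * M := by fun_prop
        simpa using this.tendsto 0
    · refine continuous_norm.continuousAt.mul (hF.continuousAt.comp ?_)
      rw [Topology.IsInducing.subtypeVal.continuousAt_iff]
      have hc : ContinuousAt (fun z : EuclideanSpace ℝ (Fin (k + 1)) => ‖z‖⁻¹ • z) z :=
        (continuous_norm.continuousAt.inv₀ (norm_ne_zero_iff.2 hz)).smul continuousAt_id
      refine hc.congr ?_
      filter_upwards [isOpen_ne.mem_nhds hz] with y hy
      have hy' : y ≠ 0 := hy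
      simp [hy']

section JoinMapping

variable {X : Type*}

/-- The join of the discrete sets `{k | x ∈ O m k}` for `m ≤ n`. -/
def joinMapping (O : ℕ → ℕ → Set X) (n : ℕ) (x : X) : Set (NonnegFinsupp (ℕ × ℕ)) :=
  {y | (∀ a, y.1 a ≠ 0 → a.1 ≤ n ∧ x ∈ O a.1 a.2) ∧
    (∀ a b, y.1 a ≠ 0 → y.1 b ≠ 0 → a.1 = b.1 → a = b) ∧ y.pairing 1 = 1}

theorem joinMapping_nonempty {O : ℕ → ℕ → Set X} (hO : ∀ m x, ∃ k, x ∈ O m k) (n : ℕ) (x : X) :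
    (joinMapping O n x).Nonempty := by
  classical
  obtain ⟨k, hk⟩ := hO 0 x
  refine ⟨⟨Finsupp.single (0, k) 1, fun i => ?_⟩, ?_, ?_, ?_⟩
  · rw [Finsupp.single_apply]
    split_ifs
    exacts [zero_le_one, le_rfl]
  · intro a ha
    obtain ⟨rfl, -⟩ := Finsupp.single_apply_ne_zero.1 ha
    exact ⟨Nat.zero_le _, hk⟩
  · intro a b ha hb _
    rw [(Finsupp.single_apply_ne_zero.1 ha).1, (Finsupp.single_apply_ne_zero.1 hb).1]
  · simp [NonnegFinsupp.pairing]

theorem lowerLocallyConstant_joinMapping [TopologicalSpace X] {O : ℕ → ℕ → Set X}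
    (hO : ∀ m k, IsOpen (O m k)) (n : ℕ) : LowerLocallyConstant (joinMapping O n) := by
  intro K hK
  rcases Set.eq_empty_or_nonempty {x | K ⊆ joinMapping O n x} with h | ⟨x₀, hx₀⟩
  · rw [h]
    exact isOpen_empty
  · have : {x | K ⊆ joinMapping O n x} =
        ⋂ a ∈ {a | ∃ y ∈ K, y.1 a ≠ 0}, O a.1 a.2 := by
      ext x
      simp only [Set.mem_iInter]
      constructor
      · rintro hx a ⟨y, hy, hya⟩
        exact ((hx hy).1 a hya).2
      · intro hx y hy
        exact ⟨fun a ha => ⟨((hx₀ hy).1 a ha).1, hx a ⟨y, hy, ha⟩⟩, (hx₀ hy).2⟩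
    rw [this]
    exact (NonnegFinsupp.finite_support_of_isCompact hK).isOpen_biInter fun a _ => hO _ _

theorem embedIn_joinMapping {O : ℕ → ℕ → Set X} (hO : ∀ m x, ∃ k, x ∈ O m k) (n : ℕ) (x : X) :
    EmbedIn n (joinMapping O n x) (joinMapping O (n + 1) x) := by
  classical
  intro f hf hfr
  obtain ⟨k, hk⟩ := hO (n + 1) x
  obtain ⟨N, hN, hNc⟩ := exists_sphere_retraction n
  have hcoord : ∀ z a, (‖z‖ • (f (N z)).1 + (1 - ‖z‖) • Finsupp.single (n + 1, k) (1 : ℝ)) a =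
      ‖z‖ * (f (N z)).1 a + (1 - ‖z‖) * if (n + 1, k) = a then 1 else 0 := by
    intro z a
    simp only [Finsupp.add_apply, Finsupp.smul_apply, Finsupp.single_apply, smul_eq_mul]
  let g : Metric.closedBall (0 : EuclideanSpace ℝ (Fin (n + 1))) 1 → NonnegFinsupp (ℕ × ℕ) :=
    fun z => ⟨‖z.1‖ • (f (N z)).1 + (1 - ‖z.1‖) • Finsupp.single (n + 1, k) (1 : ℝ), fun a => by
      have h1 : ‖z.1‖ ≤ 1 := mem_closedBall_zero_iff.1 z.2
      rw [hcoord]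
      refine add_nonneg (mul_nonneg (norm_nonneg _) ((f _).2 a)) (mul_nonneg (by linarith) ?_)
      split_ifs
      exacts [zero_le_one, le_rfl]⟩
  have hpair : ∀ z w, (g z).pairing w =
      ‖z.1‖ * (f (N z)).pairing w + (1 - ‖z.1‖) * w (n + 1, k) := by
    intro z w
    simp only [g, NonnegFinsupp.pairing, map_add, map_smul, Finsupp.linearCombination_single,
      smul_eq_mul, one_mul]
  have hsupp : ∀ z a, (g z).1 a ≠ 0 → a = (n + 1, k) ∨ (f (N z)).1 a ≠ 0 := by
    intro z a ha
    by_contra! h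
    refine ha ((hcoord z a).trans ?_)
    rw [h.2, if_neg h.1.symm]
    ring
  have hf' : ∀ z, f z ∈ joinMapping O n x := fun z => hfr ⟨z, rfl⟩
  refine ⟨g, NonnegFinsupp.continuous_iff.2 fun w => ?_, ?_, fun z => ?_⟩
  · simp only [hpair]
    have := (hNc _ ((NonnegFinsupp.continuous_pairing w).comp hf)).comp
      (continuous_subtype_val (p := (· ∈ Metric.closedBall (0 : EuclideanSpace ℝ (Fin (n + 1))) 1)))
    exact this.add (by fun_prop)
  · rintro _ ⟨z, rfl⟩
    refine ⟨fun a ha => ?_, fun a b ha hb hab => ?_, ?_⟩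
    · rcases hsupp z a ha with rfl | h
      · exact ⟨le_rfl, hk⟩
      · have := (hf' (N z)).1 a h
        exact ⟨this.1.trans (Nat.le_succ n), this.2⟩
    · rcases hsupp z a ha with rfl | ha' <;> rcases hsupp z b hb with rfl | hb'
      · rfl
      · have := ((hf' (N z)).1 b hb').1
        simp only at hab
        omega
      · have := ((hf' (N z)).1 a ha').1
        simp only at hab
        omega
      · exact (hf' (N z)).2.1 a b ha' hb' hab
    · rw [hpair, (hf' (N z)).2.2]
      simp
  · have h1 : ‖z.1‖ = 1 := mem_sphere_zero_iff_norm.1 z.2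
    refine Subtype.ext ?_
    simp [g, h1, hN]

end JoinMapping

/-- A paracompact Hausdorff space is a C-space if aspherical sequences of lower locally constant
mappings have continuous selections for their unions. -/
theorem isCSpace_of_selection {X : Type*} [TopologicalSpace X] [T2Space X] [ParacompactSpace X]
    (hX : ∀ φ : ℕ → X → Set (NonnegFinsupp (ℕ × ℕ)),
      (∀ n x, (φ n x).Nonempty) → (∀ n, LowerLocallyConstant (φ n)) →
      (∀ n x, EmbedIn n (φ n x) (φ (n + 1) x)) →
      ∃ f : X → NonnegFinsupp (ℕ × ℕ), Continuous f ∧ ∀ x, f x ∈ ⋃ n, φ n x) :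
    IsCSpace X := by
  intro U hU
  choose W hWo hWd hWr hWc using fun n =>
    exists_sigmaDisjoint_open_refinement (U n) (hU n).1 (hU n).2
  let O : ℕ → ℕ → Set X := fun m k => ⋃₀ W m k
  have hO : ∀ m x, ∃ k, x ∈ O m k := fun m x =>
    Set.mem_iUnion.1 ((hWc m).symm ▸ Set.mem_univ x)
  obtain ⟨f, hf, hfO⟩ := hX (joinMapping O) (joinMapping_nonempty hO)
    (lowerLocallyConstant_joinMapping fun m k => isOpen_sUnion (hWo m k)) (embedIn_joinMapping hO)
  let P : ℕ → ℕ → Set X := fun n k => {x | (f x).1 (n, k) ≠ 0}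
  have hPo : ∀ n k, IsOpen (P n k) := fun n k =>
    isOpen_ne_fun ((NonnegFinsupp.continuous_coord (n, k)).comp hf) continuous_const
  refine ⟨fun n => {v | ∃ k, ∃ w ∈ W n k, v = P n k ∩ w}, ?_, ?_, ?_, ?_⟩
  · rintro n _ ⟨k, w, hw, rfl⟩
    exact (hPo n k).inter (hWo n k w hw)
  · rintro n _ ⟨k, w, hw, rfl⟩ _ ⟨k', w', hw', rfl⟩ hne
    refine Set.disjoint_left.2 fun x hx hx' => ?_
    obtain ⟨N, hN⟩ := Set.mem_iUnion.1 (hfO x)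
    obtain rfl : k = k' := congrArg Prod.snd (hN.2.1 (n, k) (n, k') hx.1 hx'.1 rfl)
    exact Set.disjoint_left.1 (hWd n k hw hw' fun h => hne (h ▸ rfl)) hx.2 hx'.2
  · rintro n _ ⟨k, w, hw, rfl⟩
    obtain ⟨u, hu, hwu⟩ := hWr n k w hw
    exact ⟨u, hu, Set.inter_subset_right.trans hwu⟩
  · refine Set.eq_univ_of_forall fun x => ?_
    obtain ⟨N, hN⟩ := Set.mem_iUnion.1 (hfO x)
    have hex : ∃ a, (f x).1 a ≠ 0 := by
      by_contra! h
      have h0 : (f x).1 = 0 := Finsupp.ext h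
      have := hN.2.2
      simp [NonnegFinsupp.pairing, h0] at this
    obtain ⟨a, ha⟩ := hex
    obtain ⟨w, hw, hxw⟩ := (hN.1 a ha).2
    exact Set.mem_iUnion.2 ⟨a.1, P a.1 a.2 ∩ w, ⟨a.2, w, hw, rfl⟩, ha, hxw⟩

/-- Theorem 1.2: a paracompact Hausdorff space is a C-space iff every aspherical
sequence of lower locally constant mappings into any Hausdorff space admits a
continuous selection for its union. -/
theorem cSpace_iff_asphericalSequence_selection
    {X : Type*} [TopologicalSpace X] [T2Space X] [ParacompactSpace X] :
    IsCSpace X ↔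
      ∀ (Y : Type) [TopologicalSpace Y] [T2Space Y] (φ : ℕ → X → Set Y),
        (∀ n x, (φ n x).Nonempty) →
        (∀ n, LowerLocallyConstant (φ n)) →
        (∀ n x, EmbedIn n (φ n x) (φ (n + 1) x)) →
        ∃ f : X → Y, Continuous f ∧ ∀ x, f x ∈ ⋃ n, φ n x := by
  refine ⟨fun hX Y _ _ φ hne hφ hasp => hX.exists_selection hne hφ hasp, fun h => ?_⟩
  exact isCSpace_of_selection (h (NonnegFinsupp (ℕ × ℕ)))
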